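/- arXiv:2210.01318 — 7 statements merged into one kernel-verified Lean document; each statement's English description precedes it below -/
import Mathlib

section
/- For any privacy parameter ε > 0, any distance bound t > 0, and any pair of inputs x, x' in the integer interval [L,R] with |x - x'| ≤ t, the Global-map mechanism satisfies ε-dLDP; that is, for every output o ∈ [L,R], (exp(-|x-o|·ε/2) / Σ_{j=L}^{R} exp(-|x-j|·ε/2)) ≤ exp(t·ε) · (exp(-|x'-o|·ε/2) / Σ_{j=L}^{R} exp(-|x'-j|·ε/2)). -/
/-- The Global-map mechanism on the integer interval `[L, R]`: the probability that
input `x` is desensitized to output `o`. -/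
noncomputable def gmap (ε : ℝ) (L R x o : ℤ) : ℝ :=
  Real.exp (-|(x : ℝ) - o| * ε / 2) /
    ∑ j ∈ Finset.Icc L R, Real.exp (-|(x : ℝ) - j| * ε / 2)

/-- Moving the input by at most `t` changes the unnormalized weight of an output by a factor
of at most `exp (t * ε / 2)`. -/
lemma exp_neg_abs_sub_le {ε t a b : ℝ} (hε : 0 ≤ ε) (hab : |a - b| ≤ t) (c : ℝ) :
    Real.exp (-|a - c| * ε / 2) ≤ Real.exp (t * ε / 2) * Real.exp (-|b - c| * ε / 2) := by
  rw [← Real.exp_add]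
  gcongr
  have h : |b - c| ≤ t + |a - c| := by
    linarith [abs_sub_le b a c, abs_sub_comm a b]
  linarith [mul_le_mul_of_nonneg_right h hε]

/-- Global-map satisfies `ε`-dLDP: for inputs `x, x' ∈ [L, R]` at
distance at most `t`, every output `o ∈ [L, R]` has
`Pr[Global-map(x) = o] ≤ exp(t·ε) · Pr[Global-map(x') = o]`. -/
theorem globalMap_dLDP (ε t : ℝ) (hε : 0 < ε) (ht : 0 < t) (L R x x' : ℤ)
    (hx : x ∈ Finset.Icc L R) (hx' : x' ∈ Finset.Icc L R)
    (hdist : |(x : ℝ) - x'| ≤ t) :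
    ∀ o ∈ Finset.Icc L R, gmap ε L R x o ≤ Real.exp (t * ε) * gmap ε L R x' o := by
  intro o _
  have hsum_pos (y : ℤ) : 0 < ∑ j ∈ Finset.Icc L R, Real.exp (-|(y : ℝ) - j| * ε / 2) :=
    Finset.sum_pos (fun _ _ => Real.exp_pos _) ⟨x, hx⟩
  have hsum : ∑ j ∈ Finset.Icc L R, Real.exp (-|(x' : ℝ) - j| * ε / 2) ≤
      Real.exp (t * ε / 2) * ∑ j ∈ Finset.Icc L R, Real.exp (-|(x : ℝ) - j| * ε / 2) := by
    rw [Finset.mul_sum]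
    exact Finset.sum_le_sum fun j _ =>
      exp_neg_abs_sub_le hε.le (abs_sub_comm (x : ℝ) x' ▸ hdist) j
  have hexp : Real.exp (t * ε) = Real.exp (t * ε / 2) * Real.exp (t * ε / 2) := by
    rw [← Real.exp_add, add_halves]
  rw [gmap, gmap, ← mul_div_assoc, div_le_div_iff₀ (hsum_pos x) (hsum_pos x')]
  refine (mul_le_mul (exp_neg_abs_sub_le hε.le hdist o) hsum (hsum_pos x').le
    (by positivity)).trans_eq ?_
  rw [hexp]
  ring
end

section
/- Let x1 < x2 be inputs in the integer interval [L,R] with t = x2 - x1, let ε > 0 and q = exp(-ε/2), and let |D| = R - L + 1. If o1 and o2 are sampled independently by the Global-map mechanism applied to x1 and x2 respectively, then Pr[o2 > o1] = Σ_{o2=L}^{R} Σ_{o1=L}^{o2-1} p_{x1,o1}·p_{x2,o2} ≥ 1 - ((1-q²)·t + 1)·q^t / ((1 + q - q^{t+1} - q^{|D|-t})·(1+q)). -/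
section

open Finset

lemma sum_Icc_int_eq_sum_range {M : Type*} [AddCommMonoid M] (f : ℤ → M) (L : ℤ) (n : ℕ) :
    ∑ j ∈ Icc L (L + n - 1), f j = ∑ k ∈ range n, f (L + k) := by
  induction n with
  | zero => simp
  | succ n ih =>
    rw [sum_range_succ, ← ih]
    have : Icc L (L + (n + 1 : ℕ) - 1) = insert (L + n : ℤ) (Icc L (L + n - 1)) := by
      ext; simp; omega
    rw [this, sum_insert (by simp), add_comm]

lemma one_sub_mul_sum_range_pow_natAbs (q : ℝ) (a k : ℕ) (hk : k ≤ a) :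
    (1 - q) * ∑ j ∈ range k, q ^ ((a : ℤ) - j).natAbs = q ^ (a + 1 - k) - q ^ (a + 1) := by
  induction k with
  | zero => simp
  | succ k ih =>
    rw [sum_range_succ, mul_add, ih (by omega)]
    obtain ⟨d, rfl⟩ := Nat.exists_eq_add_of_le hk
    have h1 : (((k + 1 + d : ℕ) : ℤ) - k).natAbs = d + 1 := by omega
    have h2 : k + 1 + d + 1 - k = d + 2 := by omega
    have h3 : k + 1 + d + 1 - (k + 1) = d + 1 := by omega
    rw [h1, h2, h3]; ring

lemma one_sub_mul_sum_range_add_pow_natAbs (q : ℝ) (a i : ℕ) :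
    (1 - q) * ∑ j ∈ range (a + i), q ^ ((a : ℤ) - j).natAbs = 1 + q - q ^ (a + 1) - q ^ i := by
  induction i with
  | zero =>
    have := one_sub_mul_sum_range_pow_natAbs q a a le_rfl
    rw [add_zero, this, Nat.add_sub_cancel_left, pow_one, pow_zero]
    ring
  | succ i ih =>
    have h1 : ((a : ℤ) - (a + i : ℕ)).natAbs = i := by omega
    rw [← add_assoc, sum_range_succ, mul_add, ih, h1]; ring

lemma sum_range_pow_sub_mul_pow_succ_sub_sub (q : ℝ) (x : ℝ) (n : ℕ) :
    (1 - q) * (1 + q) * ∑ k ∈ range n, q ^ (n - k) * (q ^ (n + 1 - k) - x) =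
      q ^ 3 * (1 - q ^ (2 * n)) - x * q * (1 - q ^ n) * (1 + q) := by
  induction n with
  | zero => simp
  | succ n ih =>
    rw [sum_range_succ']
    have : ∀ k ∈ range n, q ^ (n + 1 - (k + 1)) * (q ^ (n + 1 + 1 - (k + 1)) - x) =
        q ^ (n - k) * (q ^ (n + 1 - k) - x) := fun k _ => by
      rw [Nat.add_sub_add_right, Nat.add_sub_add_right]
    rw [sum_congr rfl this, mul_add, ih, Nat.sub_zero, Nat.sub_zero]
    ring

lemma sum_range_pow_sub_mul_sub_pow (q : ℝ) (x : ℝ) (t : ℕ) :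
    (1 - q) * ∑ i ∈ range t, q ^ (t - i) * (x - q ^ i) =
      x * q * (1 - q ^ t) - (1 - q) * t * q ^ t := by
  have h : ∀ i ∈ range t, q ^ (t - i) * (x - q ^ i) = x * q ^ (t - i) - q ^ t := fun i hi => by
    rw [mul_sub, ← pow_add, Nat.sub_add_cancel (mem_range.1 hi).le, mul_comm]
  have h2 : (1 - q) * ∑ i ∈ range t, q ^ (t - i) = q * (1 - q ^ t) := by
    have := one_sub_mul_sum_range_pow_natAbs q t t le_rfl
    have h3 : ∀ i ∈ range t, q ^ (t - i) = q ^ ((t : ℤ) - i).natAbs := fun i hi => by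
      congr 1; have := mem_range.1 hi; omega
    rw [sum_congr rfl h3, this, Nat.add_sub_cancel_left]; ring
  rw [sum_congr rfl h, sum_sub_distrib, ← mul_sum, sum_const, card_range, nsmul_eq_mul]
  linear_combination x * h2

lemma sum_range_pow_mul_sub_mul_pow (q : ℝ) (x y : ℝ) (n : ℕ) :
    (1 - q) * (1 + q) * ∑ i ∈ range n, q ^ i * (x - y * q ^ i) =
      x * (1 + q) * (1 - q ^ n) - y * (1 - q ^ (2 * n)) := by
  induction n with
  | zero => simp
  | succ n ih => rw [sum_range_succ, mul_add, ih]; ring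

/-- Closed form for the (unnormalised) probability of a strictly increasing output pair. -/
lemma sum_range_pow_natAbs_mul_sum (q : ℝ) (a t b : ℕ) :
    (1 - q) ^ 2 * (1 + q) * ∑ k ∈ range (a + t + (b + 1)), ∑ j ∈ range k,
        q ^ ((a : ℤ) - j).natAbs * q ^ (((a + t : ℕ) : ℤ) - k).natAbs =
      (1 + q) * ((1 + q - q ^ (a + 1) - q ^ (b + t + 1)) *
        (1 + q - q ^ (a + t + 1) - q ^ (b + 1))) -
      q ^ t * ((1 - q ^ 2) * t + 1 + q + 2 * q ^ 2 - q * (1 + q) ^ 2 * (q ^ a + q ^ b)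
        + q ^ 3 * ((q ^ a) ^ 2 + (q ^ b) ^ 2) + q ^ 2 * (1 + q) * q ^ t * q ^ a * q ^ b) := by
  have h1 : ∀ k ∈ range a, (1 - q) * ∑ j ∈ range k,
      q ^ ((a : ℤ) - j).natAbs * q ^ (((a + t : ℕ) : ℤ) - k).natAbs =
      q ^ t * (q ^ (a - k) * (q ^ (a + 1 - k) - q ^ (a + 1))) := fun k hk => by
    have hk := (mem_range.1 hk).le
    have e : (((a + t : ℕ) : ℤ) - k).natAbs = t + (a - k) := by omega
    rw [← sum_mul, ← mul_assoc, one_sub_mul_sum_range_pow_natAbs q a k hk, e, pow_add]; ring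
  have h2 : ∀ i ∈ range t, (1 - q) * ∑ j ∈ range (a + i),
      q ^ ((a : ℤ) - j).natAbs * q ^ (((a + t : ℕ) : ℤ) - (a + i : ℕ)).natAbs =
      q ^ (t - i) * ((1 + q - q ^ (a + 1)) - q ^ i) := fun i hi => by
    have hk := (mem_range.1 hi).le
    have e : (((a + t : ℕ) : ℤ) - (a + i : ℕ)).natAbs = t - i := by omega
    rw [← sum_mul, ← mul_assoc, one_sub_mul_sum_range_add_pow_natAbs q a i, e]; ring
  have h3 : ∀ i ∈ range (b + 1), (1 - q) * ∑ j ∈ range (a + t + i),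
      q ^ ((a : ℤ) - j).natAbs * q ^ (((a + t : ℕ) : ℤ) - (a + t + i : ℕ)).natAbs =
      q ^ i * ((1 + q - q ^ (a + 1)) - q ^ t * q ^ i) := fun i _ => by
    have e : (((a + t : ℕ) : ℤ) - (a + t + i : ℕ)).natAbs = i := by omega
    rw [← sum_mul, ← mul_assoc, add_assoc a t i, one_sub_mul_sum_range_add_pow_natAbs q a (t + i),
      ← add_assoc a t i, e, pow_add]
    ring
  have key : ∀ S : ℝ, (1 - q) ^ 2 * (1 + q) * S = (1 - q) * (1 + q) * ((1 - q) * S) :=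
    fun S => by ring
  rw [key, mul_sum, sum_range_add, sum_range_add, sum_congr rfl h1, sum_congr rfl h2,
    sum_congr rfl h3, ← mul_sum]
  linear_combination q ^ t * sum_range_pow_sub_mul_pow_succ_sub_sub q (q ^ (a + 1)) a +
    (1 + q) * sum_range_pow_sub_mul_sub_pow q (1 + q - q ^ (a + 1)) t +
    sum_range_pow_mul_sub_mul_pow q (1 + q - q ^ (a + 1)) (q ^ t) (b + 1)

lemma one_sub_pow_le (q : ℝ) (h0 : 0 ≤ q) (t : ℕ) : 1 - q ^ t ≤ (1 - q) * t := by
  have := one_add_mul_le_pow (a := q - 1) (by linarith) t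
  rw [add_sub_cancel] at this
  linarith

lemma one_sub_mul_mul_pow_le (q : ℝ) (h0 : 0 ≤ q) (h1 : q ≤ 1) (t : ℕ) :
    (1 - q) * t * q ^ t ≤ q * (1 - q ^ t) := by
  induction t with
  | zero => simp
  | succ t ih =>
    have h : 0 ≤ q * (1 - q) * (1 - q ^ t) :=
      mul_nonneg (mul_nonneg h0 (by linarith)) (by linarith [pow_le_one₀ (n := t) h0 h1])
    have := mul_le_mul_of_nonneg_left ih h0
    push_cast
    rw [pow_succ]
    nlinarith

/-- The coefficient of `(1 - q ^ 2) * t` in the gap between the two sides of the bound after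
clearing denominators, with `T = q ^ t`, `A = q ^ a`, `B = q ^ b`. -/
noncomputable def prodGap (q T A B : ℝ) : ℝ :=
  (1 + q - q * A - q * B * T) * (1 + q - q * A * T - q * B) - (1 + q - q * T - q * A * B)

/-- The part not depending on `t` of the gap between the two sides of the bound after clearing
denominators, with `T = q ^ t`, `A = q ^ a`, `B = q ^ b`. -/
noncomputable def defectGap (q T A B : ℝ) : ℝ :=
  (1 + q - q * A - q * B * T) * (1 + q - q * A * T - q * B) -
    (1 + q + 2 * q ^ 2 - q * (1 + q) ^ 2 * (A + B) + q ^ 3 * (A ^ 2 + B ^ 2)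
      + q ^ 2 * (1 + q) * T * A * B) * (1 + q - q * T - q * A * B)

lemma simplex_monomial_nonneg {q T : ℝ} (hT : 0 ≤ T) (hTq : T ≤ q) (hq : q ≤ 1) (i j k : ℕ) :
    0 ≤ T ^ i * (q - T) ^ j * (1 - q) ^ k :=
  mul_nonneg (mul_nonneg (pow_nonneg hT i) (pow_nonneg (sub_nonneg.2 hTq) j))
    (pow_nonneg (sub_nonneg.2 hq) k)

/-- Nonnegativity of the gap at the smallest admissible value of `(1 - q ^ 2) * t`. -/
lemma defectGap_add_mul_prodGap_nonneg {q T A B : ℝ} (hT : 0 ≤ T) (hTq : T ≤ q) (hq : q ≤ 1)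
    (hA0 : 0 ≤ A) (hA1 : A ≤ 1) (hB0 : 0 ≤ B) (hB1 : B ≤ 1) :
    0 ≤ defectGap q T A B + (1 + q) * (1 - T) * prodGap q T A B := by
  have h0 : 0 ≤ q := hT.trans hTq
  have m (i j k : ℕ) := simplex_monomial_nonneg hT hTq hq i j k
  have a1 : 0 ≤ 1 + T - T ^ 2 - q * T ^ 2 - q ^ 2 + q ^ 2 * T := by
    linear_combination m 0 0 3 + 3 * m 0 1 2 + 2 * m 0 2 1 + 4 * m 1 0 2 + 6 * m 1 1 1 +
      2 * m 1 2 0 + 3 * m 2 0 1 + 2 * m 2 1 0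
  have a2 : 0 ≤ 1 + T - T ^ 2 - 2 * q * T + q ^ 2 * T ^ 2 + q ^ 3 - q ^ 3 * T := by
    linear_combination m 0 0 4 + 4 * m 0 1 3 + 6 * m 0 2 2 + 5 * m 0 3 1 + 2 * m 0 4 0 +
      5 * m 1 0 3 + 13 * m 1 1 2 + 14 * m 1 2 1 + 6 * m 1 3 0 + 6 * m 2 0 2 + 11 * m 2 1 1 +
      6 * m 2 2 0 + 2 * m 3 0 1 + 2 * m 3 1 0
  have a3 : 0 ≤ 1 + T - T ^ 2 + q - 6 * q * T + 2 * q * T ^ 2 + 4 * q ^ 2 - 2 * q ^ 2 * T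
      + 3 * q ^ 2 * T ^ 2 - 3 * q ^ 3 * T := by
    linear_combination m 0 0 4 + 5 * m 0 1 3 + 13 * m 0 2 2 + 15 * m 0 3 1 + 6 * m 0 4 0 +
      6 * m 1 0 3 + 23 * m 1 1 2 + 34 * m 1 2 1 + 14 * m 1 3 0 + 9 * m 2 0 2 + 23 * m 2 1 1 +
      10 * m 2 2 0 + 4 * m 3 0 1 + 2 * m 3 1 0
  have b1 : 0 ≤ 1 - 2 * T + T ^ 2 + 3 * q - 5 * q * T + 4 * q * T ^ 2 - q * T ^ 3 + 3 * q ^ 2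
      - 5 * q ^ 2 * T + 3 * q ^ 2 * T ^ 2 - q ^ 2 * T ^ 3 + q ^ 3 - 2 * q ^ 3 * T + q ^ 3 * T ^ 2 := by
    linear_combination m 0 0 5 + 8 * m 0 1 4 + 25 * m 0 2 3 + 38 * m 0 3 2 + 28 * m 0 4 1 +
      8 * m 0 5 0 + 6 * m 1 0 4 + 37 * m 1 1 3 + 82 * m 1 2 2 + 77 * m 1 3 1 + 26 * m 1 4 0 +
      13 * m 2 0 3 + 57 * m 2 1 2 + 77 * m 2 2 1 + 33 * m 2 3 0 + 13 * m 3 0 2 + 34 * m 3 1 1 +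
      21 * m 3 2 0 + 6 * m 4 0 1 + 7 * m 4 1 0 + m 5 0 0
  have b2 : 0 ≤ 2 - 4 * T + 2 * T ^ 2 + 5 * q - 8 * q * T + 7 * q * T ^ 2 - 2 * q * T ^ 3 + 3 * q ^ 2
      - 8 * q ^ 2 * T + 5 * q ^ 2 * T ^ 2 - 2 * q ^ 2 * T ^ 3 - 2 * q ^ 3 * T + 2 * q ^ 3 * T ^ 2 := by
    linear_combination 2 * m 0 0 5 + 15 * m 0 1 4 + 43 * m 0 2 3 + 59 * m 0 3 2 + 39 * m 0 4 1 +
      10 * m 0 5 0 + 11 * m 1 0 4 + 62 * m 1 1 3 + 121 * m 1 2 2 + 98 * m 1 3 1 + 28 * m 1 4 0 +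
      21 * m 2 0 3 + 78 * m 2 1 2 + 85 * m 2 2 1 + 28 * m 2 3 0 + 16 * m 3 0 2 + 30 * m 3 1 1 +
      12 * m 3 2 0 + 4 * m 4 0 1 + 2 * m 4 1 0
  have b3 : 0 ≤ 1 - 2 * T + T ^ 2 + 2 * q - 3 * q * T + 3 * q * T ^ 2 - q * T ^ 3 - 3 * q ^ 2 * T
      + 2 * q ^ 2 * T ^ 2 - q ^ 2 * T ^ 3 + q ^ 3 * T ^ 2 := by
    linear_combination m 0 0 5 + 7 * m 0 1 4 + 18 * m 0 2 3 + 22 * m 0 3 2 + 13 * m 0 4 1 +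
      3 * m 0 5 0 + 5 * m 1 0 4 + 25 * m 1 1 3 + 42 * m 1 2 2 + 29 * m 1 3 1 + 7 * m 1 4 0 +
      8 * m 2 0 3 + 24 * m 2 1 2 + 20 * m 2 2 1 + 5 * m 2 3 0 + 4 * m 3 0 2 + 4 * m 3 1 1 +
      m 3 2 0
  have hm : 0 ≤ A * B := mul_nonneg hA0 hB0
  have hm1 : 0 ≤ 1 - A * B := by nlinarith
  have hw : 0 ≤ (1 - A) * (1 - B) := mul_nonneg (by linarith) (by linarith)
  have hw1 : 0 ≤ 1 - A * B - (1 - A) * (1 - B) := by nlinarith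
  have hK := add_nonneg (add_nonneg (add_nonneg (mul_nonneg hw a1) (mul_nonneg hw1 a2))
    (mul_nonneg hm a3)) (mul_nonneg (pow_nonneg h0 3)
    (add_nonneg (mul_nonneg (mul_nonneg zero_le_two hm) hm1) (mul_nonneg hm hw)))
  have hE := add_nonneg (add_nonneg (mul_nonneg b1 (pow_nonneg hm1 2))
    (mul_nonneg (mul_nonneg b2 hm) hm1)) (mul_nonneg b3 (pow_nonneg hm 2))
  have := mul_nonneg h0 (add_nonneg (mul_nonneg hw hK) (mul_nonneg hm hE))
  refine this.trans_eq ?_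
  simp only [prodGap, defectGap]
  ring

/-- Nonnegativity of the gap, scaled by `T`, at the largest admissible value of
`(1 - q ^ 2) * t`. -/
lemma mul_defectGap_add_mul_prodGap_nonneg {q T A B : ℝ} (hT : 0 ≤ T) (hTq : T ≤ q) (hq : q ≤ 1)
    (hA0 : 0 ≤ A) (hA1 : A ≤ 1) (hB0 : 0 ≤ B) (hB1 : B ≤ 1) :
    0 ≤ T * defectGap q T A B + (1 + q) * (q * (1 - T)) * prodGap q T A B := by
  have h0 : 0 ≤ q := hT.trans hTq
  have m (i j k : ℕ) := simplex_monomial_nonneg hT hTq hq i j k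
  have a1 : 0 ≤ T ^ 2 + q - 2 * q * T + 2 * q ^ 2 - 3 * q ^ 2 * T + q ^ 2 * T ^ 2 + q ^ 3 - q ^ 3 * T := by
    linear_combination m 0 1 3 + 5 * m 0 2 2 + 8 * m 0 3 1 + 4 * m 0 4 0 + m 1 0 3 +
      8 * m 1 1 2 + 17 * m 1 2 1 + 10 * m 1 3 0 + 4 * m 2 0 2 + 12 * m 2 1 1 + 8 * m 2 2 0 +
      3 * m 3 0 1 + 2 * m 3 1 0
  have a2 : 0 ≤ T ^ 2 + q - 2 * q * T - q * T ^ 2 + 2 * q ^ 2 - 3 * q ^ 2 * T + 2 * q ^ 2 * T ^ 2 + q ^ 3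
      - q ^ 3 * T := by
    linear_combination m 0 1 3 + 5 * m 0 2 2 + 8 * m 0 3 1 + 4 * m 0 4 0 + m 1 0 3 +
      8 * m 1 1 2 + 17 * m 1 2 1 + 10 * m 1 3 0 + 4 * m 2 0 2 + 11 * m 2 1 1 + 8 * m 2 2 0 +
      2 * m 3 0 1 + 2 * m 3 1 0
  have a3 : 0 ≤ T ^ 2 + q - q * T - 3 * q * T ^ 2 + 2 * q ^ 2 - q ^ 2 * T + 4 * q ^ 2 * T ^ 2 + q ^ 3
      - 4 * q ^ 3 * T := by
    linear_combination m 0 1 3 + 5 * m 0 2 2 + 8 * m 0 3 1 + 4 * m 0 4 0 + m 1 0 3 +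
      9 * m 1 1 2 + 21 * m 1 2 1 + 10 * m 1 3 0 + 5 * m 2 0 2 + 17 * m 2 1 1 + 8 * m 2 2 0 +
      4 * m 3 0 1 + 2 * m 3 1 0
  have b1 : 0 ≤ T - T ^ 2 + 2 * q * T - 2 * q * T ^ 2 + q * T ^ 3 + q ^ 2 * T - q ^ 2 * T ^ 2 := by
    linear_combination m 1 0 3 + 5 * m 1 1 2 + 8 * m 1 2 1 + 4 * m 1 3 0 + 4 * m 2 0 2 +
      12 * m 2 1 1 + 8 * m 2 2 0 + 4 * m 3 0 1 + 5 * m 3 1 0 + m 4 0 0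
  have b2 : 0 ≤ 2 * T - 2 * T ^ 2 + 3 * q * T - 3 * q * T ^ 2 + 2 * q * T ^ 3 - 2 * q ^ 2 * T ^ 2
      - q ^ 3 * T + q ^ 3 * T ^ 2 := by
    linear_combination 2 * m 1 0 4 + 11 * m 1 1 3 + 21 * m 1 2 2 + 16 * m 1 3 1 + 4 * m 1 4 0 +
      9 * m 2 0 3 + 33 * m 2 1 2 + 34 * m 2 2 1 + 10 * m 2 3 0 + 12 * m 3 0 2 + 22 * m 3 1 1 +
      8 * m 3 2 0 + 4 * m 4 0 1 + 2 * m 4 1 0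
  have b3 : 0 ≤ T - T ^ 2 + q * T - q * T ^ 2 + q * T ^ 3 - q ^ 2 * T - q ^ 2 * T ^ 2 + q ^ 3 * T ^ 2 := by
    linear_combination m 1 0 4 + 5 * m 1 1 3 + 8 * m 1 2 2 + 5 * m 1 3 1 + m 1 4 0 +
      4 * m 2 0 3 + 12 * m 2 1 2 + 9 * m 2 2 1 + 2 * m 2 3 0 + 4 * m 3 0 2 + 4 * m 3 1 1 + m 3 2 0
  have hm : 0 ≤ A * B := mul_nonneg hA0 hB0
  have hm1 : 0 ≤ 1 - A * B := by nlinarith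
  have hw : 0 ≤ (1 - A) * (1 - B) := mul_nonneg (by linarith) (by linarith)
  have hw1 : 0 ≤ 1 - A * B - (1 - A) * (1 - B) := by nlinarith
  have hK := add_nonneg (add_nonneg (add_nonneg (mul_nonneg hw a1) (mul_nonneg hw1 a2))
    (mul_nonneg hm a3)) (mul_nonneg (mul_nonneg (pow_nonneg h0 3) hT)
    (add_nonneg (mul_nonneg (mul_nonneg zero_le_two hm) hm1) (mul_nonneg hm hw)))
  have hE := add_nonneg (add_nonneg (mul_nonneg b1 (pow_nonneg hm1 2))
    (mul_nonneg (mul_nonneg b2 hm) hm1)) (mul_nonneg b3 (pow_nonneg hm 2))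
  have := mul_nonneg h0 (add_nonneg (mul_nonneg hw hK) (mul_nonneg hm hE))
  refine this.trans_eq ?_
  simp only [prodGap, defectGap]
  ring

/-- The bound after clearing denominators: the gap is affine in `c`, so it suffices to check the
extreme values of `c`. -/
lemma defectGap_add_nonneg {q T A B c : ℝ} (hT : 0 < T) (hTq : T ≤ q) (hq : q ≤ 1)
    (hA0 : 0 ≤ A) (hA1 : A ≤ 1) (hB0 : 0 ≤ B) (hB1 : B ≤ 1)
    (hc : (1 + q) * (1 - T) ≤ c) (hcT : c * T ≤ (1 + q) * (q * (1 - T))) :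
    0 ≤ defectGap q T A B + c * prodGap q T A B := by
  rcases le_total 0 (prodGap q T A B) with hG | hG
  · have := defectGap_add_mul_prodGap_nonneg hT.le hTq hq hA0 hA1 hB0 hB1
    linarith [mul_le_mul_of_nonneg_right hc hG]
  · have := mul_defectGap_add_mul_prodGap_nonneg hT.le hTq hq hA0 hA1 hB0 hB1
    refine nonneg_of_mul_nonneg_right ?_ hT
    linarith [mul_le_mul_of_nonpos_right hcT hG]

lemma exp_neg_abs_sub_mul_half (ε : ℝ) (x o : ℤ) :
    Real.exp (-|(x : ℝ) - o| * ε / 2) = Real.exp (-ε / 2) ^ (x - o).natAbs := by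
  rw [← Real.exp_nat_mul, Nat.cast_natAbs]
  push_cast
  ring_nf

lemma gmap_add_natCast (ε : ℝ) (L : ℤ) (n a k : ℕ) :
    gmap ε L (L + n - 1) (L + a) (L + k) = Real.exp (-ε / 2) ^ ((a : ℤ) - k).natAbs /
      ∑ j ∈ range n, Real.exp (-ε / 2) ^ ((a : ℤ) - j).natAbs := by
  simp only [gmap, exp_neg_abs_sub_mul_half, sum_Icc_int_eq_sum_range, add_sub_add_left_eq_sub]

/-- The order-preserving bound for weights `q ^ |a - j|` and `q ^ |a + t - k|` on
`{0, …, a + t + b}`. -/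
lemma one_sub_le_sum_div_mul_sum_div {q : ℝ} (h0 : 0 < q) (h1 : q < 1) (a t b : ℕ) (ht : t ≠ 0) :
    1 - ((1 - q ^ 2) * t + 1) * q ^ t /
        ((1 + q - q ^ (t + 1) - q ^ (a + b + 1)) * (1 + q)) ≤
      (∑ k ∈ range (a + t + (b + 1)), ∑ j ∈ range k,
          q ^ ((a : ℤ) - j).natAbs * q ^ (((a + t : ℕ) : ℤ) - k).natAbs) /
        ((∑ j ∈ range (a + t + (b + 1)), q ^ ((a : ℤ) - j).natAbs) *
          ∑ j ∈ range (a + t + (b + 1)), q ^ (((a + t : ℕ) : ℤ) - j).natAbs) := by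
  have hS := sum_range_pow_natAbs_mul_sum q a t b
  have hZ1 := one_sub_mul_sum_range_add_pow_natAbs q a (t + (b + 1))
  have hZ2 := one_sub_mul_sum_range_add_pow_natAbs q (a + t) (b + 1)
  rw [← add_assoc] at hZ1
  set S := ∑ k ∈ range (a + t + (b + 1)), ∑ j ∈ range k,
    q ^ ((a : ℤ) - j).natAbs * q ^ (((a + t : ℕ) : ℤ) - k).natAbs
  set Z1 := ∑ j ∈ range (a + t + (b + 1)), q ^ ((a : ℤ) - j).natAbs
  set Z2 := ∑ j ∈ range (a + t + (b + 1)), q ^ (((a + t : ℕ) : ℤ) - j).natAbs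
  have hT : 0 < q ^ t := pow_pos h0 t
  have hTq : q ^ t ≤ q := pow_le_of_le_one h0.le h1.le ht
  have hA0 : 0 < q ^ a := pow_pos h0 a
  have hA1 : q ^ a ≤ 1 := pow_le_one₀ h0.le h1.le
  have hB0 : 0 < q ^ b := pow_pos h0 b
  have hB1 : q ^ b ≤ 1 := pow_le_one₀ h0.le h1.le
  have hF := defectGap_add_nonneg (c := (1 - q ^ 2) * t) hT hTq h1.le hA0.le hA1 hB0.le hB1
    (by nlinarith [one_sub_pow_le q h0.le t])
    (by nlinarith [one_sub_mul_mul_pow_le q h0.le h1.le t])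
  simp only [defectGap, prodGap] at hF
  simp only [pow_add, pow_one] at hS hZ1 hZ2 ⊢
  generalize q ^ t = T at *
  generalize q ^ a = A at *
  generalize q ^ b = B at *
  have hn : 0 < 1 + q := by linarith
  have hqA : q * A ≤ q := mul_le_of_le_one_right h0.le hA1
  have hqB : q * B ≤ q := mul_le_of_le_one_right h0.le hB1
  have hT1 : T ≤ 1 := hTq.trans h1.le
  have hqAT : q * A * T ≤ q * A := mul_le_of_le_one_right (by positivity) hT1
  have hqBT : q * B * T ≤ q * B := mul_le_of_le_one_right (by positivity) hT1
  have hqAB : q * A * B ≤ q * A := mul_le_of_le_one_right (by positivity) hB1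
  have hqT : q * T ≤ q := mul_le_of_le_one_right h0.le hT1
  have hW : 0 < 1 + q - T * q - A * B * q := by linarith
  have hz1 : 0 < 1 + q - q * A - q * B * T := by linarith
  have hz2 : 0 < 1 + q - q * A * T - q * B := by linarith
  have hr : 0 < 1 - q := by linarith
  have hZ1p : 0 < Z1 := pos_of_mul_pos_right (by rw [hZ1]; linarith) hr.le
  have hZ2p : 0 < Z2 := pos_of_mul_pos_right (by rw [hZ2]; linarith) hr.le
  rw [sub_le_iff_le_add, div_add_div _ _ (by positivity) (by positivity),
    le_div_iff₀ (by positivity), one_mul]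
  have hZ : (1 - q) ^ 2 * (Z1 * Z2) =
      (1 + q - q * A - q * B * T) * (1 + q - q * A * T - q * B) := by
    linear_combination (1 - q) * Z2 * hZ1 + (1 + q - q * A - q * B * T) * hZ2
  refine le_of_mul_le_mul_left ?_ (pow_pos hr 2)
  have := mul_nonneg hT.le hF
  linear_combination this - (1 + q - T * q - A * B * q) * hS +
    ((1 + q - T * q - A * B * q) * (1 + q) - ((1 - q ^ 2) * t + 1) * T) * hZ

end

/-- Order-preserving probability of Global-map: for inputs
`x1 < x2` in `[L, R]` with `t = x2 - x1`, `q = exp(-ε/2)` and `|D| = R - L + 1`,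
`Pr[o2 > o1] = Σ_{o2=L}^{R} Σ_{o1=L}^{o2-1} p_{x1,o1}·p_{x2,o2}
  ≥ 1 - ((1-q²)·t + 1)·q^t / ((1 + q - q^{t+1} - q^{|D|-t})·(1+q))`. -/
theorem globalMap_order_preserving (ε : ℝ) (hε : 0 < ε) (L R x1 x2 : ℤ)
    (hx1 : x1 ∈ Finset.Icc L R) (hx2 : x2 ∈ Finset.Icc L R) (hlt : x1 < x2) :
    let t : ℤ := x2 - x1
    let q : ℝ := Real.exp (-ε / 2)
    let D : ℤ := R - L + 1
    1 - ((1 - q ^ 2) * (t : ℝ) + 1) * q ^ t /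
        ((1 + q - q ^ (t + 1) - q ^ (D - t)) * (1 + q))
      ≤ ∑ o2 ∈ Finset.Icc L R, ∑ o1 ∈ Finset.Icc L (o2 - 1),
          gmap ε L R x1 o1 * gmap ε L R x2 o2 := by
  intro t q D
  obtain ⟨hL1, -⟩ := Finset.mem_Icc.1 hx1
  obtain ⟨-, hR2⟩ := Finset.mem_Icc.1 hx2
  obtain ⟨a, ha⟩ := Int.eq_ofNat_of_zero_le (sub_nonneg.2 hL1)
  obtain ⟨s, hs⟩ := Int.eq_ofNat_of_zero_le (sub_nonneg.2 hlt.le)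
  obtain ⟨b, hb⟩ := Int.eq_ofNat_of_zero_le (sub_nonneg.2 hR2)
  obtain rfl : x1 = L + a := by omega
  obtain rfl : x2 = L + (a + s : ℕ) := by push_cast; omega
  obtain rfl : R = L + (a + s + (b + 1) : ℕ) - 1 := by push_cast at *; omega
  have ht : t = s := hs
  have hD : D - t = (a + b + 1 : ℕ) := by rw [ht]; simp only [D]; push_cast; ring
  have ht1 : t + 1 = (s + 1 : ℕ) := by rw [ht]; push_cast; rfl
  have hq1 : q < 1 := Real.exp_lt_one_iff.2 (by linarith)
  have key := one_sub_le_sum_div_mul_sum_div (Real.exp_pos (-ε / 2)) hq1 a s b (by omega)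
  rw [hD, ht1, ht, zpow_natCast, zpow_natCast, zpow_natCast, Int.cast_natCast]
  refine key.trans_eq ?_
  simp only [sum_Icc_int_eq_sum_range, gmap_add_natCast, Finset.sum_div, div_mul_div_comm]
end

section
/- Let the domain be the integer interval [L,R] of size |D| = R - L + 1, let ε > 0, p1 = e^ε/(|D| + e^ε - 1), p2 = 1/(|D| + e^ε - 1). For any inputs x1 < x2 in [L,R] with t = x2 - x1, if o1 and o2 are sampled independently by GRR applied to x1 and x2, then Pr[o2 > o1] = p1² + p1·p2·(|D| - 3) + p2²·(½·|D|·(|D| - 3) + 2) + p2·(p1 - p2)·t. -/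
/-- Generalized Random Response (GRR) on the integer interval `[L, R]`:
the true value is output with probability `p1 = e^ε/(|D| + e^ε - 1)` and each other
value of the domain with probability `p2 = 1/(|D| + e^ε - 1)`, `|D| = R - L + 1`. -/
noncomputable def grr (ε : ℝ) (L R x o : ℤ) : ℝ :=
  if o = x then Real.exp ε / (((R : ℝ) - L + 1) + Real.exp ε - 1)
  else 1 / (((R : ℝ) - L + 1) + Real.exp ε - 1)

/-- The sum of the offsets `o - L` over the integer interval `[L, R]`. -/
theorem sum_Icc_int_sub_left {L R : ℤ} (h : L ≤ R + 1) :
    ∑ o ∈ Finset.Icc L R, ((o : ℝ) - L) = ((R : ℝ) - L + 1) * ((R : ℝ) - L) / 2 := by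
  obtain ⟨n, hn⟩ := Int.eq_ofNat_of_zero_le (show 0 ≤ R + 1 - L by lia)
  obtain rfl : R = L + n - 1 := by lia
  clear h hn
  induction n with
  | zero => simp
  | succ n ih =>
    have hIcc : Finset.Icc L (L + (n + 1 : ℕ) - 1) =
        insert (L + (n : ℤ)) (Finset.Icc L (L + n - 1)) := by
      ext o
      simp only [Finset.mem_Icc, Finset.mem_insert]
      lia
    rw [hIcc, Finset.sum_insert (by simp), ih]
    push_cast
    ring

/-- The number of integers in an interval, as a real number. -/
theorem card_Icc_int_cast {a b : ℤ} (h : a ≤ b + 1) :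
    ((Finset.Icc a b).card : ℝ) = (b : ℝ) - a + 1 := by
  have hc : ((Finset.Icc a b).card : ℤ) = b + 1 - a := by
    rw [Int.card_Icc]
    lia
  have hr : ((Finset.Icc a b).card : ℝ) = ((b + 1 - a : ℤ) : ℝ) := by exact_mod_cast hc
  rw [hr]
  push_cast
  ring

/-- The probability that `o1 < o2` when each input `x` is reported with weight `q + d` and every
other value of `[L, R]` with weight `q`. -/
theorem sum_lt_point_perturbation (q d : ℝ) {L R x1 x2 : ℤ}
    (hx1 : x1 ∈ Finset.Icc L R) (hx2 : x2 ∈ Finset.Icc L R) (hlt : x1 < x2) :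
    ∑ o2 ∈ Finset.Icc L R, ∑ o1 ∈ Finset.Icc L (o2 - 1),
        (q + if o1 = x1 then d else 0) * (q + if o2 = x2 then d else 0)
      = q ^ 2 * (((R : ℝ) - L + 1) * ((R : ℝ) - L) / 2)
        + q * d * ((R : ℝ) - x1) + q * d * ((x2 : ℝ) - L) + d ^ 2 := by
  have hx1' := Finset.mem_Icc.mp hx1
  have hinner : ∀ o2 ∈ Finset.Icc L R, ∑ o1 ∈ Finset.Icc L (o2 - 1),
        (q + if o1 = x1 then d else 0) * (q + if o2 = x2 then d else 0)
      = q ^ 2 * ((o2 : ℝ) - L) + (if x1 < o2 then q * d else 0)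
        + if o2 = x2 then q * d * ((x2 : ℝ) - L) + d ^ 2 else 0 := by
    intro o2 ho2
    have ho2' := Finset.mem_Icc.mp ho2
    have hmem : x1 ∈ Finset.Icc L (o2 - 1) ↔ x1 < o2 := by
      rw [Finset.mem_Icc]
      lia
    rw [← Finset.sum_mul, Finset.sum_add_distrib, Finset.sum_const, nsmul_eq_mul,
      card_Icc_int_cast (by lia), Finset.sum_ite_eq']
    simp only [hmem]
    push_cast
    by_cases h2 : o2 = x2
    · subst h2
      simp only [hlt, if_true]
      ring
    · simp only [h2, if_false]
      split_ifs <;> ring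
  have hfilter : (Finset.Icc L R).filter (x1 < ·) = Finset.Icc (x1 + 1) R := by
    ext o
    simp only [Finset.mem_filter, Finset.mem_Icc]
    lia
  rw [Finset.sum_congr rfl hinner, Finset.sum_add_distrib, Finset.sum_add_distrib,
    ← Finset.mul_sum, sum_Icc_int_sub_left (by lia), ← Finset.sum_filter, hfilter,
    Finset.sum_const, nsmul_eq_mul, card_Icc_int_cast (by lia), Finset.sum_ite_eq', if_pos hx2]
  push_cast
  ring

/-- GRR is the uniform weight `p2` plus an excess `p1 - p2` at the true value. -/
theorem grr_eq_add_ite (ε : ℝ) (L R x o : ℤ) :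
    grr ε L R x o = 1 / (((R : ℝ) - L + 1) + Real.exp ε - 1)
      + if o = x then Real.exp ε / (((R : ℝ) - L + 1) + Real.exp ε - 1)
        - 1 / (((R : ℝ) - L + 1) + Real.exp ε - 1) else 0 := by
  unfold grr
  split_ifs <;> ring

/-- Order-preserving probability of GRR: for inputs `x1 < x2` in
`[L, R]` with `t = x2 - x1`,
`Pr[o2 > o1] = p1² + p1·p2·(|D| - 3) + p2²·(½·|D|·(|D| - 3) + 2) + p2·(p1 - p2)·t`. -/
theorem grr_order_preserving (ε : ℝ) (hε : 0 < ε) (L R x1 x2 : ℤ)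
    (hx1 : x1 ∈ Finset.Icc L R) (hx2 : x2 ∈ Finset.Icc L R) (hlt : x1 < x2) :
    let D : ℝ := (R : ℝ) - L + 1
    let p1 : ℝ := Real.exp ε / (D + Real.exp ε - 1)
    let p2 : ℝ := 1 / (D + Real.exp ε - 1)
    ∑ o2 ∈ Finset.Icc L R, ∑ o1 ∈ Finset.Icc L (o2 - 1),
        grr ε L R x1 o1 * grr ε L R x2 o2
      = p1 ^ 2 + p1 * p2 * (D - 3) + p2 ^ 2 * ((1 / 2) * D * (D - 3) + 2)
        + p2 * (p1 - p2) * ((x2 : ℝ) - x1) := by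
  intro D p1 p2
  simp only [grr_eq_add_ite]
  rw [sum_lt_point_perturbation _ _ hx1 hx2 hlt]
  change p2 ^ 2 * (D * ((R : ℝ) - L) / 2) + p2 * (p1 - p2) * ((R : ℝ) - x1)
    + p2 * (p1 - p2) * ((x2 : ℝ) - L) + (p1 - p2) ^ 2 = _
  have hR : (R : ℝ) = D + L - 1 := by simp only [D]; ring
  rw [hR]
  ring
end

section
/- Let P be an integer interval of length θ and ε > 0. For any two integer inputs x, x' (not necessarily inside P) and any output o ∈ P, the within-partition exponential mechanism satisfies (exp(-|x-o|·ε/2) / Σ_{v∈P} exp(-|x-v|·ε/2)) ≤ exp(θ·ε) · (exp(-|x'-o|·ε/2) / Σ_{v∈P} exp(-|x'-v|·ε/2)). -/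
/-- Within-partition exponential mechanism: let `P = [a, a+θ-1]` be
an integer interval of length `θ`. For any integer inputs `x, x'` (not necessarily
inside `P`) and any output `o ∈ P`,
`(exp(-|x-o|·ε/2) / Σ_{v∈P} exp(-|x-v|·ε/2))
  ≤ exp(θ·ε) · (exp(-|x'-o|·ε/2) / Σ_{v∈P} exp(-|x'-v|·ε/2))`. -/
theorem within_partition_exp_mech (ε : ℝ) (hε : 0 < ε) (a θ : ℤ) (hθ : 0 < θ)
    (x x' o : ℤ) (ho : o ∈ Finset.Icc a (a + θ - 1)) :
    Real.exp (-|(x : ℝ) - o| * ε / 2) /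
        (∑ v ∈ Finset.Icc a (a + θ - 1), Real.exp (-|(x : ℝ) - v| * ε / 2))
      ≤ Real.exp ((θ : ℝ) * ε) *
        (Real.exp (-|(x' : ℝ) - o| * ε / 2) /
          ∑ v ∈ Finset.Icc a (a + θ - 1), Real.exp (-|(x' : ℝ) - v| * ε / 2)) := by
  have hpos (y : ℤ) :
      0 < ∑ v ∈ Finset.Icc a (a + θ - 1), Real.exp (-|(y : ℝ) - v| * ε / 2) :=
    Finset.sum_pos (fun _ _ => Real.exp_pos _) ⟨o, ho⟩
  rw [← mul_div_assoc, div_le_div_iff₀ (hpos x) (hpos x'), Finset.mul_sum, Finset.mul_sum]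
  refine Finset.sum_le_sum fun v hv => ?_
  rw [← Real.exp_add, ← Real.exp_add, ← Real.exp_add, Real.exp_le_exp]
  rw [Finset.mem_Icc] at ho hv
  have hvo : |(v : ℝ) - o| ≤ θ := by
    have h : |v - o| ≤ θ := abs_le.mpr ⟨by omega, by omega⟩
    exact_mod_cast h
  have hx : |(x : ℝ) - v| ≤ |(x : ℝ) - o| + θ := by
    have := abs_sub_le (x : ℝ) o v
    rw [abs_sub_comm (o : ℝ) v] at this
    linarith
  have hx' : |(x' : ℝ) - o| ≤ |(x' : ℝ) - v| + θ := by
    have := abs_sub_le (x' : ℝ) v o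
    linarith
  nlinarith [mul_le_mul_of_nonneg_right (add_le_add hx hx') hε.le]
end

section
/- Let ε > 0, q = exp(-ε/2), and let m1 ≤ m2 be inputs in the integer interval [1,k] with T = m2 - m1. If o1 and o2 are sampled independently by the Global-map mechanism on [1,k] with parameter ε applied to m1 and m2 respectively, then the collision probability satisfies Pr[o1 = o2] = Σ_{o=1}^{k} p_{m1,o}·p_{m2,o} ≥ ((1-q)²·(T+1)/(1+q)²)·q^T. -/
/-- A sum of powers of `q` with distinct exponents is at most the full geometric series. -/
theorem sum_pow_le_of_injOn {ι : Type*} {q : ℝ} (h0 : 0 ≤ q) (h1 : q < 1) (s : Finset ι)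
    (f : ι → ℕ) (hf : Set.InjOn f s) : ∑ i ∈ s, q ^ f i ≤ (1 - q)⁻¹ := by
  classical
  rw [← Finset.sum_image (f := fun n => q ^ n) hf]
  exact sum_le_hasSum _ (fun n _ => pow_nonneg h0 n) (hasSum_geometric_of_lt_one h0 h1)

theorem sum_pow_natAbs_sub_le {q : ℝ} (h0 : 0 ≤ q) (h1 : q < 1) (s : Finset ℤ) (m : ℤ) :
    ∑ j ∈ s, q ^ (m - j).natAbs ≤ (1 + q) / (1 - q) := by
  rw [← Finset.sum_filter_add_sum_filter_not s (fun j => m ≤ j)]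
  have hright : ∑ j ∈ s with m ≤ j, q ^ (m - j).natAbs ≤ (1 - q)⁻¹ := by
    refine sum_pow_le_of_injOn h0 h1 _ _ fun a ha b hb hab => ?_
    simp only [Finset.coe_filter, Set.mem_ofPred_eq] at ha hb
    omega
  have hleft : ∑ j ∈ s with ¬ m ≤ j, q ^ (m - j).natAbs ≤ q * (1 - q)⁻¹ := by
    have hshift : ∑ j ∈ s with ¬ m ≤ j, q ^ (m - j).natAbs
        = q * ∑ j ∈ s with ¬ m ≤ j, q ^ (m - 1 - j).natAbs := by
      rw [Finset.mul_sum]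
      refine Finset.sum_congr rfl fun j hj => ?_
      rw [← pow_succ']
      congr 1
      have := (Finset.mem_filter.mp hj).2
      omega
    rw [hshift]
    refine mul_le_mul_of_nonneg_left (sum_pow_le_of_injOn h0 h1 _ _ fun a ha b hb hab => ?_) h0
    simp only [Finset.coe_filter, Set.mem_ofPred_eq] at ha hb
    omega
  calc _ ≤ (1 - q)⁻¹ + q * (1 - q)⁻¹ := add_le_add hright hleft
    _ = (1 + q) / (1 - q) := by ring

theorem exp_neg_abs_sub_eq_pow (ε : ℝ) (m j : ℤ) :
    Real.exp (-|(m : ℝ) - j| * ε / 2) = Real.exp (-ε / 2) ^ (m - j).natAbs := by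
  rw [← Real.exp_nat_mul, Nat.cast_natAbs]
  push_cast
  ring_nf

theorem gmap_nonneg (ε : ℝ) (L R x o : ℤ) : 0 ≤ gmap ε L R x o := by
  unfold gmap
  positivity

theorem le_gmap {ε : ℝ} (hε : 0 < ε) {L R x : ℤ} (hx : x ∈ Finset.Icc L R) (o : ℤ) :
    (1 - Real.exp (-ε / 2)) / (1 + Real.exp (-ε / 2)) * Real.exp (-ε / 2) ^ (x - o).natAbs
      ≤ gmap ε L R x o := by
  have h1 : Real.exp (-ε / 2) < 1 := Real.exp_lt_one_iff.mpr (by linarith)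
  have hsum := sum_pow_natAbs_sub_le (Real.exp_pos (-ε / 2)).le h1 (Finset.Icc L R) x
  unfold gmap
  simp only [exp_neg_abs_sub_eq_pow]
  have hpos : 0 < ∑ j ∈ Finset.Icc L R, Real.exp (-ε / 2) ^ (x - j).natAbs :=
    Finset.sum_pos (fun j _ => by positivity) ⟨x, hx⟩
  rw [div_eq_inv_mul _ (∑ j ∈ _, _), ← inv_div]
  gcongr

/-- Collision probability of Global-map on `[1, k]`: for inputs
`m1 ≤ m2` with `T = m2 - m1` and `q = exp(-ε/2)`,
`Pr[o1 = o2] = Σ_{o=1}^{k} p_{m1,o}·p_{m2,o} ≥ ((1-q)²·(T+1)/(1+q)²)·q^T`. -/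
theorem globalMap_collision_prob (ε : ℝ) (hε : 0 < ε) (k m1 m2 : ℤ)
    (h1 : m1 ∈ Finset.Icc (1 : ℤ) k) (h2 : m2 ∈ Finset.Icc (1 : ℤ) k)
    (hle : m1 ≤ m2) :
    let T : ℤ := m2 - m1
    let q : ℝ := Real.exp (-ε / 2)
    ((1 - q) ^ 2 * ((T : ℝ) + 1) / (1 + q) ^ 2) * q ^ T
      ≤ ∑ o ∈ Finset.Icc (1 : ℤ) k, gmap ε 1 k m1 o * gmap ε 1 k m2 o := by

  intro T q
  have hq : 0 < q := Real.exp_pos _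
  have hq1 : q < 1 := Real.exp_lt_one_iff.mpr (by linarith)
  have hc : 0 ≤ (1 - q) / (1 + q) := div_nonneg (by linarith) (by linarith)
  have hsub : Finset.Icc m1 m2 ⊆ Finset.Icc 1 k :=
    Finset.Icc_subset_Icc (Finset.mem_Icc.mp h1).1 (Finset.mem_Icc.mp h2).2
  have hcard : ((Finset.Icc m1 m2).card : ℝ) = (T : ℝ) + 1 := by
    have h : ((Finset.Icc m1 m2).card : ℤ) = T + 1 := by
      rw [Int.card_Icc_of_le _ _ (by omega)]
      ring
    exact_mod_cast h
  calc ((1 - q) ^ 2 * ((T : ℝ) + 1) / (1 + q) ^ 2) * q ^ T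
      = ∑ o ∈ Finset.Icc m1 m2, ((1 - q) / (1 + q)) ^ 2 * q ^ T := by
        rw [Finset.sum_const, nsmul_eq_mul, hcard, div_pow]
        ring
    _ ≤ ∑ o ∈ Finset.Icc m1 m2, gmap ε 1 k m1 o * gmap ε 1 k m2 o := by
        refine Finset.sum_le_sum fun o ho => ?_
        obtain ⟨ho1, ho2⟩ := Finset.mem_Icc.mp ho
        have hT : T = (((m1 - o).natAbs + (m2 - o).natAbs : ℕ) : ℤ) := by omega
        calc ((1 - q) / (1 + q)) ^ 2 * q ^ T
            = ((1 - q) / (1 + q) * q ^ (m1 - o).natAbs)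
              * ((1 - q) / (1 + q) * q ^ (m2 - o).natAbs) := by
              rw [hT, zpow_natCast, pow_add]
              ring
          _ ≤ _ := mul_le_mul (le_gmap hε h1 o) (le_gmap hε h2 o)
              (mul_nonneg hc (pow_nonneg hq.le _)) (gmap_nonneg _ _ _ _ _)
    _ ≤ _ := Finset.sum_le_sum_of_subset_of_nonneg hsub fun o _ _ =>
        mul_nonneg (gmap_nonneg _ _ _ _ _) (gmap_nonneg _ _ _ _ _)
end

section
/- The bounded discrete Laplace mechanism with parameter ε on output range [l,u] satisfies 2ε-dLDP: for any integers x1, x2 with |x1 - x2| ≤ t and any output o ∈ [l,u], (exp(-ε·|o - x1|) / Σ_{z=l}^{u} exp(-ε·|z - x1|)) ≤ exp(2·t·ε) · (exp(-ε·|o - x2|) / Σ_{z=l}^{u} exp(-ε·|z - x2|)). -/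
/-- Moving the centre of the Laplace weight by at most `t` changes it by a factor at most
`exp (t * ε)`. -/
theorem exp_neg_mul_abs_sub_le {ε t a b : ℝ} (hε : 0 ≤ ε) (hab : |a - b| ≤ t) (z : ℝ) :
    Real.exp (-ε * |z - a|) ≤ Real.exp (t * ε) * Real.exp (-ε * |z - b|) := by
  rw [← Real.exp_add, Real.exp_le_exp]
  have h : |z - b| ≤ |z - a| + t := (abs_sub_le z a b).trans (by gcongr)
  linarith [mul_le_mul_of_nonneg_left h hε]

/-- The bounded discrete Laplace mechanism with parameter `ε` on
output range `[l, u]` satisfies `2ε`-dLDP: for integers `x1, x2` with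
`|x1 - x2| ≤ t` and any output `o ∈ [l, u]`,
`(exp(-ε·|o-x1|) / Σ_{z=l}^{u} exp(-ε·|z-x1|))
  ≤ exp(2·t·ε) · (exp(-ε·|o-x2|) / Σ_{z=l}^{u} exp(-ε·|z-x2|))`. -/
theorem boundedDiscreteLaplace_dLDP (ε t : ℝ) (hε : 0 < ε) (l u : ℤ) (hlu : l ≤ u)
    (x1 x2 : ℤ) (hd : |(x1 : ℝ) - x2| ≤ t) (o : ℤ) (ho : o ∈ Finset.Icc l u) :
    Real.exp (-ε * |(o : ℝ) - x1|) /
        (∑ z ∈ Finset.Icc l u, Real.exp (-ε * |(z : ℝ) - x1|))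
      ≤ Real.exp (2 * t * ε) *
        (Real.exp (-ε * |(o : ℝ) - x2|) /
          ∑ z ∈ Finset.Icc l u, Real.exp (-ε * |(z : ℝ) - x2|)) := by
  have sum_pos (x : ℤ) : 0 < ∑ z ∈ Finset.Icc l u, Real.exp (-ε * |(z : ℝ) - x|) :=
    Finset.sum_pos (fun _ _ => Real.exp_pos _) ⟨o, ho⟩
  have hsum : ∑ z ∈ Finset.Icc l u, Real.exp (-ε * |(z : ℝ) - x2|) ≤
      Real.exp (t * ε) * ∑ z ∈ Finset.Icc l u, Real.exp (-ε * |(z : ℝ) - x1|) := by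
    rw [Finset.mul_sum]
    exact Finset.sum_le_sum fun z _ =>
      exp_neg_mul_abs_sub_le hε.le (by rwa [abs_sub_comm]) z
  rw [← mul_div_assoc, div_le_div_iff₀ (sum_pos x1) (sum_pos x2)]
  calc
    _ ≤ (Real.exp (t * ε) * Real.exp (-ε * |(o : ℝ) - x2|)) *
        (Real.exp (t * ε) * ∑ z ∈ Finset.Icc l u, Real.exp (-ε * |(z : ℝ) - x1|)) :=
      mul_le_mul (exp_neg_mul_abs_sub_le hε.le hd o) hsum (sum_pos x2).le (by positivity)
    _ = _ := by
      rw [show 2 * t * ε = t * ε + t * ε by ring, Real.exp_add]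
      ring
end

section
/- Sequential composition for partition-dLDP: let M_1, ..., M_k be randomized mechanisms on an integer input domain that is divided into partitions of length θ, where each M_i satisfies (ε_prt^i, ε_ner^i)-partition-dLDP. Then the composed mechanism M(x) = (M_1(x), ..., M_k(x)), with independent internal randomness, satisfies (Σ_{i=1}^{k} ε_prt^i, Σ_{i=1}^{k} ε_ner^i)-partition-dLDP: for any inputs x, y with |x - y| ≤ t and any output tuple (r_1, ..., r_k), Π_{i=1}^{k} Pr[M_i(x) = r_i] ≤ exp(⌈t/θ⌉·Σ_{i=1}^{k} ε_prt^i + θ·Σ_{i=1}^{k} ε_ner^i) · Π_{i=1}^{k} Pr[M_i(y) = r_i]. -/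
/-- Sequential composition for partition-dLDP on a domain divided
into partitions of length `θ`: if each mechanism `M i` (given by probability mass
functions `M i x : O i → ℝ`) satisfies `(εp i, εn i)`-partition-dLDP, then the
composed mechanism `x ↦ (M 0 x, ..., M (k-1) x)` with independent internal
randomness satisfies `(Σ i, εp i, Σ i, εn i)`-partition-dLDP: for any inputs `x, y`
with `|x - y| ≤ t` and any output tuple `r`,
`Π i, Pr[M i x = r i] ≤ exp(⌈t/θ⌉·Σ i, εp i + θ·Σ i, εn i) · Π i, Pr[M i y = r i]`. -/
theorem partition_dLDP_sequential_composition (k : ℕ) (O : Fin k → Type*)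
    (M : (i : Fin k) → ℤ → O i → ℝ) (εp εn : Fin k → ℝ) (θ : ℤ) (hθ : 0 < θ)
    (hnonneg : ∀ (i : Fin k) (x : ℤ) (r : O i), 0 ≤ M i x r)
    (hpdldp : ∀ (i : Fin k) (t : ℝ) (x y : ℤ), |(x : ℝ) - y| ≤ t →
      ∀ r : O i,
        M i x r ≤ Real.exp ((⌈t / (θ : ℝ)⌉ : ℝ) * εp i + (θ : ℝ) * εn i) * M i y r)
    (t : ℝ) (x y : ℤ) (hd : |(x : ℝ) - y| ≤ t) (r : (i : Fin k) → O i) :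
    ∏ i, M i x (r i)
      ≤ Real.exp ((⌈t / (θ : ℝ)⌉ : ℝ) * ∑ i, εp i + (θ : ℝ) * ∑ i, εn i) *
        ∏ i, M i y (r i) := by
  rw [Finset.mul_sum, Finset.mul_sum, ← Finset.sum_add_distrib, Real.exp_sum,
    ← Finset.prod_mul_distrib]
  exact Finset.prod_le_prod (fun i _ => hnonneg i x (r i))
    (fun i _ => hpdldp i t x y hd (r i))
end
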